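/- arXiv:1609.04892 — 6 statements merged into one kernel-verified Lean document; each statement's English description precedes it below -/
import Mathlib

section
/- Let k be a field, V a k-vector space of dimension 2, m a natural number, and L : Fin m → Submodule k V a family of lines (one-dimensional subspaces) such that at least three of the lines L i are pairwise distinct. Let Φ be the k-linear map from End(V) to the product over i of Hom(L i, V ⧸ L i) sending ψ to the family of maps (quotient map V → V ⧸ L i) ∘ ψ ∘ (inclusion L i → V). Then the kernel of Φ is exactly the one-dimensional space of scalar endomorphisms c • id, and the range of Φ has dimension 3; consequently the cokernel of Φ has dimension m − 3. (For m = g+3 this computes dim Ext¹(F,F) = g for a microlocal-rank-one object F.) -/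
open Module

/-- The linear map `End(V) → ∏ i, Hom(L i, V ⧸ L i)` sending `ψ` to the family
`i ↦ (quotient map V → V ⧸ L i) ∘ ψ ∘ (inclusion L i → V)`. -/
noncomputable def endoToHomFamily (k : Type*) {V : Type*} [Field k] [AddCommGroup V]
    [Module k V] {m : ℕ} (L : Fin m → Submodule k V) :
    (Module.End k V) →ₗ[k] (Π i : Fin m, (L i →ₗ[k] V ⧸ L i)) :=
  LinearMap.pi fun i =>
    (LinearMap.lcomp k (V ⧸ L i) (L i).subtype).comp
      (LinearMap.llcomp k V V (V ⧸ L i) (L i).mkQ)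

theorem mem_ker_endoToHomFamily_iff {k V : Type*} [Field k] [AddCommGroup V] [Module k V]
    {m : ℕ} (L : Fin m → Submodule k V) (ψ : Module.End k V) :
    ψ ∈ LinearMap.ker (endoToHomFamily k L) ↔ ∀ i, ∀ x ∈ L i, ψ x ∈ L i := by
  simp [endoToHomFamily, LinearMap.mem_ker, funext_iff, LinearMap.ext_iff]

theorem Submodule.exists_smul_eq_of_finrank_eq_one {k V : Type*} [Field k] [AddCommGroup V]
    [Module k V] {L : Submodule k V} (hL : Module.finrank k L = 1) {x y : V}
    (hx : x ∈ L) (hx0 : x ≠ 0) (hy : y ∈ L) : ∃ c : k, c • x = y := by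
  obtain ⟨c, hc⟩ := _root_.exists_smul_eq_of_finrank_eq_one hL (x := ⟨x, hx⟩)
    (by simpa [Subtype.ext_iff] using hx0) ⟨y, hy⟩
  exact ⟨c, congrArg Subtype.val hc⟩

theorem Submodule.disjoint_of_finrank_eq_one_of_ne {k V : Type*} [Field k] [AddCommGroup V]
    [Module k V] {L M : Submodule k V} (hL : Module.finrank k L = 1)
    (hM : Module.finrank k M = 1) (h : L ≠ M) : Disjoint L M := by
  rw [Submodule.disjoint_def]
  intro x hxL hxM
  by_contra hx
  apply h
  apply le_antisymm
  · intro y hy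
    obtain ⟨c, rfl⟩ := Submodule.exists_smul_eq_of_finrank_eq_one hL hxL hx hy
    exact M.smul_mem c hxM
  · intro y hy
    obtain ⟨c, rfl⟩ := Submodule.exists_smul_eq_of_finrank_eq_one hM hxM hx hy
    exact L.smul_mem c hxL

/-- An endomorphism preserving three pairwise disjoint lines, two of which span the space,
is a scalar. -/
theorem LinearMap.exists_eq_smul_id_of_three_lines {k V : Type*} [Field k] [AddCommGroup V]
    [Module k V] {A B C : Submodule k V} (hA : Module.finrank k A = 1)
    (hB : Module.finrank k B = 1) (hC : Module.finrank k C = 1) (hAB : IsCompl A B)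
    (hAC : Disjoint A C) (hBC : Disjoint B C) (ψ : V →ₗ[k] V) (hψA : ∀ x ∈ A, ψ x ∈ A)
    (hψB : ∀ x ∈ B, ψ x ∈ B) (hψC : ∀ x ∈ C, ψ x ∈ C) :
    ∃ c : k, ψ = c • (LinearMap.id : V →ₗ[k] V) := by
  rw [Submodule.disjoint_def] at hAC hBC
  have hdisj := Submodule.disjoint_def.mp hAB.disjoint
  have htop : ∀ v : V, ∃ x ∈ A, ∃ y ∈ B, x + y = v := fun v =>
    Submodule.mem_sup.mp (hAB.sup_eq_top ▸ Submodule.mem_top)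
  have : Nontrivial C := Module.nontrivial_of_finrank_pos (R := k) (by omega)
  obtain ⟨⟨w, hw⟩, hw0⟩ := exists_ne (0 : C)
  replace hw0 : w ≠ 0 := by simpa [Subtype.ext_iff] using hw0
  obtain ⟨c, hc⟩ := Submodule.exists_smul_eq_of_finrank_eq_one hC hw hw0 (hψC w hw)
  obtain ⟨x, hx, y, hy, rfl⟩ := htop w
  have hx0 : x ≠ 0 := by
    rintro rfl
    rw [zero_add] at hw hw0
    exact hw0 (hBC y hy hw)
  have hy0 : y ≠ 0 := by
    rintro rfl
    rw [add_zero] at hw hw0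
    exact hw0 (hAC x hx hw)
  have hxy : ψ x - c • x = c • y - ψ y := by
    rw [map_add, smul_add] at hc
    rw [sub_eq_sub_iff_add_eq_add, ← hc, add_comm]
  have hzero : ψ x - c • x = 0 := by
    refine hdisj _ (A.sub_mem (hψA x hx) (A.smul_mem c hx)) ?_
    rw [hxy]
    exact B.sub_mem (B.smul_mem c hy) (hψB y hy)
  have hψx : ψ x = c • x := sub_eq_zero.mp hzero
  have hψy : ψ y = c • y := (sub_eq_zero.mp (hxy ▸ hzero)).symm
  refine ⟨c, LinearMap.ext fun v => ?_⟩
  obtain ⟨a, ha, b, hb, rfl⟩ := htop v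
  obtain ⟨s, rfl⟩ := Submodule.exists_smul_eq_of_finrank_eq_one hA hx hx0 ha
  obtain ⟨t, rfl⟩ := Submodule.exists_smul_eq_of_finrank_eq_one hB hy hy0 hb
  simp [hψx, hψy, smul_comm c]

/-- For a family of lines in a 2-dimensional vector space, at least three of which are
pairwise distinct, the map `Φ : End(V) → ∏ i, Hom(L i, V ⧸ L i)` has kernel exactly the
scalar endomorphisms, range of dimension 3, and cokernel of dimension `m - 3`. -/
theorem endoToHomFamily_ker_range_coker
    {k V : Type*} [Field k] [AddCommGroup V] [Module k V]
    [FiniteDimensional k V] (hV : Module.finrank k V = 2)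
    (m : ℕ) (L : Fin m → Submodule k V)
    (hL : ∀ i, Module.finrank k (L i) = 1)
    (h3 : ∃ i j l : Fin m, L i ≠ L j ∧ L i ≠ L l ∧ L j ≠ L l) :
    (∀ ψ : Module.End k V, ψ ∈ LinearMap.ker (endoToHomFamily k L) ↔
        ∃ c : k, ψ = c • (LinearMap.id : V →ₗ[k] V)) ∧
    Module.finrank k (LinearMap.range (endoToHomFamily k L)) = 3 ∧
    Module.finrank k
        ((Π i : Fin m, (L i →ₗ[k] V ⧸ L i)) ⧸ LinearMap.range (endoToHomFamily k L))
      = m - 3 := by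
  have hker : ∀ ψ : Module.End k V, ψ ∈ LinearMap.ker (endoToHomFamily k L) ↔
      ∃ c : k, ψ = c • (LinearMap.id : V →ₗ[k] V) := by
    intro ψ
    rw [mem_ker_endoToHomFamily_iff]
    constructor
    · intro h
      obtain ⟨i, j, l, hij, hil, hjl⟩ := h3
      have hdij := Submodule.disjoint_of_finrank_eq_one_of_ne (hL i) (hL j) hij
      have hcompl : IsCompl (L i) (L j) :=
        ⟨hdij, codisjoint_iff.mpr (Submodule.eq_top_of_disjoint _ _ (by rw [hL, hL, hV]) hdij)⟩
      exact LinearMap.exists_eq_smul_id_of_three_lines (hL i) (hL j) (hL l) hcompl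
        (Submodule.disjoint_of_finrank_eq_one_of_ne (hL i) (hL l) hil)
        (Submodule.disjoint_of_finrank_eq_one_of_ne (hL j) (hL l) hjl) ψ (h i) (h j) (h l)
    · rintro ⟨c, rfl⟩ i x hx
      exact (L i).smul_mem c hx
  have : Nontrivial V := Module.nontrivial_of_finrank_pos (R := k) (by omega)
  have hspan : LinearMap.ker (endoToHomFamily k L) = k ∙ (LinearMap.id : V →ₗ[k] V) := by
    ext ψ
    rw [hker, Submodule.mem_span_singleton]
    simp only [eq_comm]
  have hkerrank : Module.finrank k (LinearMap.ker (endoToHomFamily k L)) = 1 := by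
    rw [hspan]
    exact finrank_span_singleton (one_ne_zero : (1 : Module.End k V) ≠ 0)
  have hrange : Module.finrank k (LinearMap.range (endoToHomFamily k L)) = 3 := by
    have h := LinearMap.finrank_range_add_finrank_ker (endoToHomFamily k L)
    rw [hkerrank, Module.finrank_linearMap, hV] at h
    omega
  have hcodomain : Module.finrank k (Π i : Fin m, (L i →ₗ[k] V ⧸ L i)) = m := by
    have hquot : ∀ i, Module.finrank k (V ⧸ L i) = 1 := fun i => by
      have h := (L i).finrank_quotient_add_finrank
      rw [hL, hV] at h
      omega
    simp [Module.finrank_pi_fintype, Module.finrank_linearMap, hL, hquot]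
  refine ⟨hker, hrange, ?_⟩
  rw [Submodule.finrank_quotient, hrange, hcodomain]
end

section
/- Let K be a finite field with q elements and let ℙ¹(K) be the projectivization of K². Let G be a finite simple graph containing a triangle. On the finite set of proper colorings of G with colors in ℙ¹(K), consider the equivalence relation: c ∼ c′ iff there exists g ∈ GL₂(K) with c′ = P(g) ∘ c. Then the number of equivalence classes, multiplied by q³ − q, equals the total number of proper ℙ¹(K)-colorings of G. (Since #ℙ¹(K) = q+1, the number of proper colorings is the chromatic evaluation P_G(q+1), so this is the formula #M(F_q) = P_G(q+1)/(q³−q) of Proposition 1.1.) -/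
/-- The map on the projectivization `ℙ¹(K) = ℙ(K²)` induced by an invertible matrix
`g ∈ GL₂(K)`. -/
noncomputable def projectiveAction {K : Type*} [Field K] (g : GL (Fin 2) K) :
    Projectivization K (Fin 2 → K) → Projectivization K (Fin 2 → K) :=
  Projectivization.map
    ((LinearMap.GeneralLinearGroup.generalLinearEquiv K (Fin 2 → K)
        (Matrix.GeneralLinearGroup.toLin g) : (Fin 2 → K) →ₗ[K] (Fin 2 → K)))
    (LinearMap.GeneralLinearGroup.generalLinearEquiv K (Fin 2 → K)
        (Matrix.GeneralLinearGroup.toLin g)).injective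

open MulAction Projectivization Matrix.ProjGenLinGroup
open scoped LinearAlgebra.Projectivization MatrixGroups

theorem projectiveAction_eq_smul {K : Type*} [Field K] (g : GL (Fin 2) K)
    (x : ℙ K (Fin 2 → K)) : projectiveAction g x = mk g • x := by
  induction x using Projectivization.ind with | _ v hv => rfl

/-- The projective general linear group of degree two over a field with `q` elements has
`q³ - q` elements. -/
theorem Matrix.ProjGenLinGroup.card_fin_two (K : Type*) [Field K] [Fintype K] :
    Nat.card PGL(2, K) = Fintype.card K ^ 3 - Fintype.card K := by
  have hcenter : Nat.card (Subgroup.center (GL (Fin 2) K)) = Fintype.card K - 1 := by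
    have hinj : Function.Injective (Matrix.GeneralLinearGroup.scalar (Fin 2) (R := K)) := by
      intro u v huv
      have := congrArg (fun g : GL (Fin 2) K => (g : Matrix (Fin 2) (Fin 2) K) 0 0) huv
      exact Units.ext (by simpa using this)
    rw [Matrix.GeneralLinearGroup.center_eq_range_scalar,
      ← Nat.card_congr (MonoidHom.ofInjective hinj).toEquiv, Nat.card_units,
      Nat.card_eq_fintype_card]
  have h := Subgroup.card_eq_card_quotient_mul_card_subgroup (Subgroup.center (GL (Fin 2) K))
  rw [hcenter, Matrix.card_GL_field] at h
  have hq : 1 < Fintype.card K := Fintype.one_lt_card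
  change _ = Nat.card PGL(2, K) * _ at h
  refine Nat.eq_of_mul_eq_mul_right (Nat.sub_pos_of_lt hq) (h.symm.trans ?_)
  have h₁ : 1 ≤ Fintype.card K ^ 2 := Nat.one_le_pow _ _ hq.le
  have h₂ : Fintype.card K ≤ Fintype.card K ^ 2 := Nat.le_self_pow two_ne_zero _
  have h₃ : Fintype.card K ≤ Fintype.card K ^ 3 := Nat.le_self_pow three_ne_zero _
  simp only [Fin.prod_univ_two, Fin.val_zero, Fin.val_one, pow_zero, pow_one]
  zify [hq.le, h₁, h₂, h₃]
  ring

/-- An element of `PGL₂(K)` fixing three distinct points of `ℙ¹(K)` is the identity. -/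
theorem Projectivization.eq_one_of_smul_eq_of_ne {K : Type*} [Field K] (g : PGL(2, K))
    {x y z : ℙ K (Fin 2 → K)} (hxy : x ≠ y) (hyz : y ≠ z) (hxz : x ≠ z)
    (hx : g • x = x) (hy : g • y = y) (hz : g • z = z) : g = 1 := by
  induction g using Matrix.ProjGenLinGroup.induction_on with | mk g =>
  induction x using Projectivization.ind with | _ u hu =>
  induction y using Projectivization.ind with | _ v hv =>
  induction z using Projectivization.ind with | _ w hw =>
  have hli : LinearIndependent K ![u, v] := by
    rwa [← independent_mk_iff_LinearIndependent hu hv, independent_pair_iff_ne]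
  rw [PGL.mk_smul_mk, mk_eq_mk_iff'] at hx hy hz
  obtain ⟨l, hl⟩ := hx
  obtain ⟨m, hm⟩ := hy
  obtain ⟨n, hn⟩ := hz
  have hspan : ∀ t : Fin 2 → K, ∃ a b : K, a • u + b • v = t := by
    have := hli.span_eq_top_of_card_eq_finrank (by simp)
    intro t
    rw [← Submodule.mem_span_pair, ← Matrix.range_cons_cons_empty, this]
    trivial
  obtain ⟨a, b, rfl⟩ := hspan w
  have ha : a ≠ 0 := by
    rintro rfl
    exact hyz ((mk_eq_mk_iff' K _ _ hw hv).2 ⟨b, by simp⟩).symm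
  have hb : b ≠ 0 := by
    rintro rfl
    exact hxz ((mk_eq_mk_iff' K _ _ hw hu).2 ⟨a, by simp⟩).symm
  rw [smul_add g, smul_comm g a, smul_comm g b, ← hl, ← hm] at hn
  obtain ⟨h₁, h₂⟩ := LinearIndependent.pair_iff.1 hli (n * a - a * l) (n * b - b * m) (by
    rw [← sub_eq_zero] at hn
    rw [← hn]
    module)
  have hnl : n = l := mul_left_cancel₀ ha (by linear_combination h₁)
  have hnm : n = m := mul_left_cancel₀ hb (by linear_combination h₂)
  subst hnl hnm
  have hg : ∀ t : Fin 2 → K, g • t = n • t := by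
    intro t
    obtain ⟨c, d, rfl⟩ := hspan t
    rw [smul_add g, smul_comm g c, smul_comm g d, ← hl, ← hm, smul_add, smul_comm n, smul_comm n]
  have hn0 : n ≠ 0 := by
    rintro rfl
    exact (smul_ne_zero_iff_ne g).2 hu (by simpa using hg u)
  have hscalar : 1 * Matrix.GeneralLinearGroup.scalar (Fin 2) (Units.mk0 n hn0) = g := by
    ext i j
    have := congrFun (hg (Pi.single j 1)) i
    simp only [Units.smul_def, Matrix.smul_eq_mulVec, Matrix.mulVec_single_one,
      Matrix.col_apply, Pi.smul_apply, smul_eq_mul] at this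
    simp [this, Matrix.diagonal_apply, Pi.single_apply]
  rw [← mk_one, eq_comm, Matrix.ProjGenLinGroup.mk_eq_mk_iff]
  exact ⟨_, hscalar⟩

/-- `PGL₂(K)` acts on the proper `ℙ¹(K)`-colorings of a graph by postcomposition. -/
noncomputable instance {K : Type*} [Field K] {α : Type*} (G : SimpleGraph α) :
    MulAction PGL(2, K)
      {f : α → ℙ K (Fin 2 → K) // ∀ u v : α, G.Adj u v → f u ≠ f v} where
  smul g c := ⟨g • c.1, fun u v h => (MulAction.injective g).ne (c.2 u v h)⟩
  one_smul c := Subtype.ext (one_smul _ c.1)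
  mul_smul g h c := Subtype.ext (mul_smul g h c.1)

/-- Over a finite field `K` with `q` elements, for a finite simple graph `G` containing a
triangle, the number of `GL₂(K)`-orbits of proper `ℙ¹(K)`-colorings of `G`, multiplied by
`q³ - q`, equals the total number of proper `ℙ¹(K)`-colorings:
`#M(F_q) = P_G(q+1)/(q³-q)`. -/
theorem card_orbits_mul_eq_card_colorings
    {K : Type*} [Field K] [Fintype K] {α : Type*} [Fintype α] (G : SimpleGraph α)
    (htri : ∃ a b c : α, G.Adj a b ∧ G.Adj b c ∧ G.Adj a c) :
    Nat.card (Quot (fun c c' :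
        {f : α → Projectivization K (Fin 2 → K) // ∀ u v : α, G.Adj u v → f u ≠ f v} =>
        ∃ g : GL (Fin 2) K, ∀ v : α, c'.1 v = projectiveAction g (c.1 v)))
      * (Fintype.card K ^ 3 - Fintype.card K)
    = Nat.card
        {f : α → Projectivization K (Fin 2 → K) // ∀ u v : α, G.Adj u v → f u ≠ f v} := by
  let X := {f : α → ℙ K (Fin 2 → K) // ∀ u v : α, G.Adj u v → f u ≠ f v}
  obtain ⟨a, b, c, hab, hbc, hac⟩ := htri
  have hfree : ∀ f : X, stabilizer PGL(2, K) f = ⊥ := by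
    intro f
    refine (Subgroup.eq_bot_iff_forall _).2 fun g hg => ?_
    have hfix : ∀ v, g • f.1 v = f.1 v := fun v => congrFun (congrArg Subtype.val hg) v
    exact eq_one_of_smul_eq_of_ne g (f.2 _ _ hab) (f.2 _ _ hbc) (f.2 _ _ hac)
      (hfix a) (hfix b) (hfix c)
  rw [← Matrix.ProjGenLinGroup.card_fin_two,
    Nat.card_congr (selfEquivOrbitsQuotientProd hfree), Nat.card_prod]
  congr 1
  refine Nat.card_congr (Quot.congrRight fun f f' => ?_)
  change _ ↔ f ∈ orbit PGL(2, K) f'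
  rw [← orbitRel_apply, Setoid.comm', orbitRel_apply]
  constructor
  · rintro ⟨g, hg⟩
    exact ⟨mk g, Subtype.ext (funext fun v => by rw [hg v, projectiveAction_eq_smul]; rfl)⟩
  · rintro ⟨g, hg⟩
    obtain ⟨g, rfl⟩ := mk_surjective g
    exact ⟨g, fun v => by rw [projectiveAction_eq_smul, ← hg]; rfl⟩
end

section
/- (Birkhoff's leading-coefficients theorem.) Let G be a finite simple graph with n ≥ 2 vertices and e edges. For every natural number c ≥ 1, the number N(c) of proper colorings of G with c colors satisfies |N(c) − cⁿ + e·cⁿ⁻¹| ≤ 2ᵉ · cⁿ⁻². In particular the chromatic count has the form P_G(c) = cⁿ − e·cⁿ⁻¹ + O(cⁿ⁻²). -/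
/-- The maps that are constant on a pair of distinct points are determined by their values
off one of these points. -/
theorem card_filter_map_isDiag {α β : Type*} [Fintype α] [DecidableEq α] [Fintype β]
    [DecidableEq β] {s : Sym2 α} (hs : ¬ s.IsDiag) :
    (Finset.univ.filter fun f : α → β => (s.map f).IsDiag).card
      = Fintype.card β ^ (Fintype.card α - 1) := by
  induction s with
  | _ u v =>
  have huv : v ≠ u := fun h => hs (by simp [h])
  rw [← Fintype.card_subtype]
  have key : Function.Bijective
      (fun (f : {f : α → β // (Sym2.map f s(u, v)).IsDiag}) (a : {a : α // a ≠ u}) => f.1 a) := by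
    constructor
    · rintro ⟨f, hf⟩ ⟨g, hg⟩ h
      simp only [Sym2.map_mk, Sym2.mk_isDiag_iff] at hf hg
      have h' : ∀ a, a ≠ u → f a = g a := fun a ha => congrFun h ⟨a, ha⟩
      ext a
      by_cases ha : a = u
      · rw [ha]
        exact hf.trans ((h' v huv).trans hg.symm)
      · exact h' a ha
    · intro g
      refine ⟨⟨fun a => if h : a = u then g ⟨v, huv⟩ else g ⟨a, h⟩, by simp [huv]⟩, ?_⟩
      ext ⟨a, ha⟩
      simp [ha]
  rw [Fintype.card_of_bijective key, Fintype.card_fun, Fintype.card_subtype_compl]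
  simp

theorem card_filter_map_isDiag_and_le {α β : Type*} [Fintype α] [DecidableEq α] [Fintype β]
    [DecidableEq β] {s t : Sym2 α} (hs : ¬ s.IsDiag) (ht : ¬ t.IsDiag) (hst : s ≠ t) :
    (Finset.univ.filter fun f : α → β => (s.map f).IsDiag ∧ (t.map f).IsDiag).card
      ≤ Fintype.card β ^ (Fintype.card α - 2) := by
  obtain ⟨u, v, x, y, rfl, rfl, hux, huy, hvu, hyx⟩ : ∃ u v x y : α,
      s = s(u, v) ∧ t = s(x, y) ∧ u ≠ x ∧ u ≠ y ∧ v ≠ u ∧ y ≠ x := by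
    induction s with
    | _ u v =>
    induction t with
    | _ x y =>
    simp only [Sym2.mk_isDiag_iff] at hs ht
    by_cases h : u ≠ x ∧ u ≠ y
    · exact ⟨u, v, x, y, rfl, rfl, h.1, h.2, Ne.symm hs, Ne.symm ht⟩
    · refine ⟨v, u, x, y, Sym2.eq_swap, rfl, ?_, ?_, hs, Ne.symm ht⟩ <;>
        grind [Sym2.eq_iff]
  rw [← Fintype.card_subtype]
  have key : Function.Injective
      (fun (f : {f : α → β // (Sym2.map f s(u, v)).IsDiag ∧ (Sym2.map f s(x, y)).IsDiag})
        (a : {a : α // a ∉ ({u, x} : Finset α)}) => f.1 a) := by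
    rintro ⟨f, hf⟩ ⟨g, hg⟩ h
    simp only [Sym2.map_mk, Sym2.mk_isDiag_iff] at hf hg
    have h' : ∀ a, a ≠ u → a ≠ x → f a = g a := fun a ha hb => congrFun h ⟨a, by simp [ha, hb]⟩
    have hx : f x = g x := hf.2.trans ((h' y huy.symm hyx).trans hg.2.symm)
    have hne : ∀ a, a ≠ u → f a = g a := fun a ha => by
      by_cases hb : a = x
      · rw [hb, hx]
      · exact h' a ha hb
    ext a
    by_cases ha : a = u
    · rw [ha]
      exact hf.1.trans ((hne v hvu).trans hg.1.symm)
    · exact hne a ha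
  refine (Fintype.card_le_of_injective _ key).trans_eq ?_
  rw [Fintype.card_fun, Fintype.card_subtype_compl, Fintype.card_coe, Finset.card_pair hux]

/-- The first two Bonferroni inequalities, for the properties `p i`, `i ∈ E`, of the points of a
finite type `Ω`. -/
theorem bonferroni_two {ι Ω : Type*} [DecidableEq ι] [Fintype Ω] (E : Finset ι)
    (p : ι → Ω → Prop) [∀ i, DecidablePred (p i)] :
    0 ≤ (Nat.card {ω // ∀ i ∈ E, ¬ p i ω} : ℤ) - Fintype.card Ω
        + ∑ i ∈ E, ((Finset.univ.filter (p i)).card : ℤ) ∧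
    2 * ((Nat.card {ω // ∀ i ∈ E, ¬ p i ω} : ℤ) - Fintype.card Ω
        + ∑ i ∈ E, ((Finset.univ.filter (p i)).card : ℤ))
      ≤ ∑ q ∈ E.offDiag, ((Finset.univ.filter fun ω => p q.1 ω ∧ p q.2 ω).card : ℤ) := by
  let m : Ω → ℕ := fun ω => (E.filter fun i => p i ω).card
  have h0 : ∀ ω, (∀ i ∈ E, ¬ p i ω) ↔ m ω = 0 := fun ω => by
    simp [m, Finset.filter_eq_empty_iff]
  have hlhs : (Nat.card {ω // ∀ i ∈ E, ¬ p i ω} : ℤ) - Fintype.card Ω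
        + ∑ i ∈ E, ((Finset.univ.filter (p i)).card : ℤ)
      = ∑ ω, ((if m ω = 0 then 1 else 0) - 1 + (m ω : ℤ)) := by
    simp only [h0, Nat.card_eq_fintype_card, Fintype.card_subtype, m,
      Finset.natCast_card_filter, Finset.sum_add_distrib, Finset.sum_sub_distrib]
    rw [Finset.sum_comm (s := E)]
    simp
  have hrhs : ∑ q ∈ E.offDiag, ((Finset.univ.filter fun ω => p q.1 ω ∧ p q.2 ω).card : ℤ)
      = ∑ ω, (m ω : ℤ) * (m ω - 1) := by
    simp only [Finset.natCast_card_filter]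
    rw [Finset.sum_comm]
    refine Finset.sum_congr rfl fun ω _ => ?_
    have hoff : E.offDiag.filter (fun q => p q.1 ω ∧ p q.2 ω)
        = (E.filter fun i => p i ω).offDiag := by
      ext q
      simp only [Finset.mem_filter, Finset.mem_offDiag]
      tauto
    rw [← Finset.natCast_card_filter, hoff, Finset.offDiag_card, Nat.cast_sub (Nat.le_mul_self _)]
    push_cast
    ring
  rw [hlhs, hrhs, Finset.mul_sum]
  constructor
  · refine Finset.sum_nonneg fun ω _ => ?_
    split_ifs <;> omega
  · refine Finset.sum_le_sum fun ω _ => ?_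
    split_ifs with h
    · simp [h]
    · obtain h1 | h1 : m ω = 1 ∨ 2 ≤ m ω := by omega
      · simp [h1]
      · have : (2 : ℤ) ≤ m ω := by exact_mod_cast h1
        nlinarith

theorem mul_sub_one_le_two_mul_two_pow (e : ℕ) : e * (e - 1) ≤ 2 * 2 ^ e := by
  rw [← Nat.div_mul_cancel (Nat.even_mul_pred_self e).two_dvd,
    ← Nat.choose_two_right, mul_comm]
  exact Nat.mul_le_mul_left 2 (Nat.choose_le_two_pow e 2)


/-- Birkhoff's leading-coefficients theorem: for a finite simple graph with `n ≥ 2`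
vertices and `e` edges, the number `N(c)` of proper colorings with `c ≥ 1` colors
satisfies `|N(c) - cⁿ + e·cⁿ⁻¹| ≤ 2ᵉ·cⁿ⁻²`, i.e. `P_G(c) = cⁿ - e·cⁿ⁻¹ + O(cⁿ⁻²)`. -/
theorem chromatic_leading_coefficients
    {α : Type*} [Fintype α] (G : SimpleGraph α) (n e : ℕ)
    (hn : n = Fintype.card α) (hn2 : 2 ≤ n)
    (he : e = Nat.card G.edgeSet)
    (c : ℕ) (hc : 1 ≤ c) :
    |(Nat.card {f : α → Fin c // ∀ u v : α, G.Adj u v → f u ≠ f v} : ℤ)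
        - (c : ℤ) ^ n + (e : ℤ) * (c : ℤ) ^ (n - 1)|
      ≤ 2 ^ e * (c : ℤ) ^ (n - 2) := by
  classical
  subst hn
  have hN : Nat.card {f : α → Fin c // ∀ u v : α, G.Adj u v → f u ≠ f v}
      = Nat.card {f : α → Fin c // ∀ s ∈ G.edgeFinset, ¬ (s.map f).IsDiag} := by
    refine Nat.card_congr (Equiv.subtypeEquivRight fun f => ?_)
    simp [Sym2.forall]
  have hE : G.edgeFinset.card = e := by
    rw [he, Nat.card_eq_fintype_card, SimpleGraph.edgeFinset_card]
  have hdiag : ∀ s ∈ G.edgeFinset, ¬ s.IsDiag := fun s hs =>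
    G.not_isDiag_of_mem_edgeSet (SimpleGraph.mem_edgeFinset.1 hs)
  have hsum : ∑ s ∈ G.edgeFinset,
      ((Finset.univ.filter fun f : α → Fin c => (s.map f).IsDiag).card : ℤ)
      = e * (c : ℤ) ^ (Fintype.card α - 1) := by
    rw [Finset.sum_congr rfl fun s hs => by rw [card_filter_map_isDiag (hdiag s hs)]]
    simp [hE]
  have hpairs : ∑ q ∈ G.edgeFinset.offDiag, ((Finset.univ.filter fun f : α → Fin c =>
        (q.1.map f).IsDiag ∧ (q.2.map f).IsDiag).card : ℤ)
      ≤ 2 * (2 ^ e * (c : ℤ) ^ (Fintype.card α - 2)) := by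
    have hcard : G.edgeFinset.offDiag.card ≤ 2 * 2 ^ e := by
      rw [Finset.offDiag_card, hE, ← Nat.mul_sub_one]
      exact mul_sub_one_le_two_mul_two_pow e
    calc _ ≤ ∑ _q ∈ G.edgeFinset.offDiag, (c : ℤ) ^ (Fintype.card α - 2) := by
          refine Finset.sum_le_sum fun q hq => ?_
          obtain ⟨h1, h2, hne⟩ := Finset.mem_offDiag.1 hq
          have := card_filter_map_isDiag_and_le (β := Fin c) (hdiag _ h1) (hdiag _ h2) hne
          rw [Fintype.card_fin] at this
          exact_mod_cast this
      _ ≤ _ := by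
          rw [Finset.sum_const, nsmul_eq_mul, ← mul_assoc]
          gcongr
          exact_mod_cast hcard
  obtain ⟨hlow, hup⟩ := bonferroni_two G.edgeFinset fun s (f : α → Fin c) => (s.map f).IsDiag
  rw [hsum, Fintype.card_fun, Fintype.card_fin, Nat.cast_pow] at hlow hup
  rw [hN, abs_of_nonneg hlow]
  linarith
end

section
/- Let g ≥ 1 and let G be a finite simple graph with exactly g+3 vertices and exactly 3g+3 edges. Then for all sufficiently large natural numbers x, the number N(x+1) of proper colorings of G with x+1 colors satisfies N(x+1) < (x−1)^g · (x³ − x). (This is the numerical heart of the paper's Theorem that the genus-g Legendrian surface of a simple cubic planar graph admits no smooth oriented graded exact Lagrangian filling: an exact filling would give a torus chart (𝔾ₘ)^g ↪ M, contributing (q−1)^g distinct F_q-points to the moduli space, but the moduli space has only P_Ĝ(q+1)/(q³−q) points, which is too small.) -/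
/-- Functions identifying two given distinct points are at least as many as the functions on the
complement of one of these points. -/
theorem card_pow_le_card_filter_apply_eq {α β : Type*} [Fintype α] [DecidableEq α] [Fintype β]
    [DecidableEq β] {n : ℕ} (hn : Fintype.card α = n + 1) {u v : α} (huv : u ≠ v) :
    Fintype.card β ^ n ≤ (Finset.univ.filter fun f : α → β => f u = f v).card := by
  have hcard : Fintype.card ({w : α // w ≠ u} → β) = Fintype.card β ^ n := by
    simp [Fintype.card_subtype_compl, hn]
  rw [← hcard, ← Finset.card_univ]
  refine Finset.card_le_card_of_injOn
    (fun h w => if hw : w = u then h ⟨v, huv.symm⟩ else h ⟨w, hw⟩) ?_ ?_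
  · intro h _
    simp [huv.symm]
  · intro h _ k _ hhk
    funext w
    simpa [w.2] using congrFun hhk w

/-- Functions satisfying two independent coincidences of values are determined by their
restriction to the complement of two points. -/
theorem card_filter_apply_eq_and_le {α β : Type*} [Fintype α] [DecidableEq α] [Fintype β]
    [DecidableEq β] {n : ℕ} (hn : Fintype.card α = n + 2) {a b c d : α} (hab : a ≠ b)
    (hcd : c ≠ d) (hac : a ≠ c) (had : a ≠ d) :
    (Finset.univ.filter fun f : α → β => f a = f b ∧ f c = f d).card ≤ Fintype.card β ^ n := by
  have hcompl : Fintype.card {w : α // w ∉ ({a, c} : Finset α)} = n := by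
    simp only [Fintype.card_subtype_compl, Fintype.card_coe, hn, Finset.card_pair hac]
    rfl
  have hcard : Fintype.card ({w : α // w ∉ ({a, c} : Finset α)} → β) = Fintype.card β ^ n := by
    rw [Fintype.card_fun, hcompl]
  rw [← hcard, ← Finset.card_univ]
  refine Finset.card_le_card_of_injOn (fun f w => f w) (fun _ _ => Finset.mem_univ _) ?_
  intro f hf k hk hfk
  simp only [Finset.coe_filter, Finset.mem_univ, true_and, Set.mem_ofPred_eq] at hf hk
  have off : ∀ w, w ≠ a → w ≠ c → f w = k w := fun w hwa hwc =>
    congrFun hfk ⟨w, by simp [hwa, hwc]⟩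
  have hc : f c = k c := by rw [hf.2, hk.2, off d had.symm hcd.symm]
  have ha : f a = k a := by
    rw [hf.1, hk.1]
    by_cases hbc : b = c
    · rw [hbc, hc]
    · exact off b hab.symm hbc
  funext w
  by_cases hwa : w = a
  · rw [hwa, ha]
  by_cases hwc : w = c
  · rw [hwc, hc]
  exact off w hwa hwc

/-- A second-order Bonferroni inequality for the elements avoiding a family of predicates. -/
theorem card_filter_forall_not_le {ι X : Type*} [Fintype X] [DecidableEq ι] (s : Finset ι)
    (P : ι → X → Prop) [∀ i, DecidablePred (P i)] :
    ((Finset.univ.filter fun x => ∀ i ∈ s, ¬ P i x).card : ℤ) ≤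
      Fintype.card X - ∑ i ∈ s, ((Finset.univ.filter (P i)).card : ℤ) +
        ∑ p ∈ s.offDiag, ((Finset.univ.filter fun x => P p.1 x ∧ P p.2 x).card : ℤ) := by
  have hpoint : ∀ x : X, (if ∀ i ∈ s, ¬ P i x then (1 : ℤ) else 0) ≤
      1 - ∑ i ∈ s, (if P i x then (1 : ℤ) else 0) +
        ∑ p ∈ s.offDiag, (if P p.1 x ∧ P p.2 x then (1 : ℤ) else 0) := by
    intro x
    set t := s.filter fun i => P i x with ht
    have hoff : s.offDiag.filter (fun p => P p.1 x ∧ P p.2 x) = t.offDiag := by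
      ext p
      simp only [ht, Finset.mem_filter, Finset.mem_offDiag]
      tauto
    rw [Finset.sum_boole, Finset.sum_boole, hoff, ← ht, Finset.offDiag_card,
      Nat.cast_sub (Nat.le_mul_self _), Nat.cast_mul]
    split_ifs with h
    · have : t = ∅ := Finset.filter_eq_empty_iff.2 fun i hi => h i hi
      simp [this]
    · nlinarith [sq_nonneg ((t.card : ℤ) - 1)]
  have hsum := Finset.sum_le_sum fun x (_ : x ∈ Finset.univ) => hpoint x
  rw [Finset.sum_add_distrib, Finset.sum_sub_distrib, Finset.sum_comm,
    Finset.sum_comm (t := s.offDiag)] at hsum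
  simpa only [Finset.sum_boole, Finset.sum_const, Finset.card_univ, nsmul_eq_mul, mul_one]
    using hsum

/-- The number of proper colorings of a graph with `n + 2` vertices and `m` edges is at most
`q ^ (n + 2) - m * q ^ (n + 1) + m ^ 2 * q ^ n`. -/
theorem card_proper_colorings_le {α β : Type*} [Fintype α] [Fintype β] (G : SimpleGraph α)
    {n : ℕ} (hn : Fintype.card α = n + 2) :
    (Nat.card {f : α → β // ∀ u v : α, G.Adj u v → f u ≠ f v} : ℤ) ≤
      (Fintype.card β : ℤ) ^ (n + 2) - Nat.card G.edgeSet * (Fintype.card β : ℤ) ^ (n + 1) +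
        (Nat.card G.edgeSet : ℤ) ^ 2 * (Fintype.card β : ℤ) ^ n := by
  classical
  have hE : Nat.card G.edgeSet = G.edgeFinset.card := by
    rw [Nat.card_eq_fintype_card, SimpleGraph.edgeFinset_card]
  obtain ⟨P, hP⟩ : ∃ P : Sym2 α → (α → β) → Prop, ∀ u v f, P s(u, v) f ↔ f u = f v :=
    ⟨fun e f => (e.map f).IsDiag, fun _ _ _ => Iff.rfl⟩
  have hN : Nat.card {f : α → β // ∀ u v : α, G.Adj u v → f u ≠ f v} =
      (Finset.univ.filter fun f => ∀ e ∈ G.edgeFinset, ¬ P e f).card := by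
    rw [Nat.card_eq_fintype_card, Fintype.card_subtype]
    congr 1
    ext f
    simp only [Finset.mem_filter, Finset.mem_univ, true_and, SimpleGraph.mem_edgeFinset]
    exact ⟨fun h e => e.ind fun u v he => (hP u v f).not.2 (h u v he),
      fun h u v huv => (hP u v f).not.1 (h s(u, v) huv)⟩
  have hsingle : (G.edgeFinset.card : ℤ) * (Fintype.card β : ℤ) ^ (n + 1) ≤
      ∑ e ∈ G.edgeFinset, ((Finset.univ.filter (P e)).card : ℤ) := by
    rw [← nsmul_eq_mul]
    refine Finset.card_nsmul_le_sum _ _ _ fun e he => ?_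
    induction e with
    | _ u v =>
      have huv : G.Adj u v := by simpa using he
      exact_mod_cast (card_pow_le_card_filter_apply_eq (β := β) hn huv.ne).trans
        (Finset.card_le_card fun f hf => by simpa [hP] using hf)
  have hpair : ∑ p ∈ G.edgeFinset.offDiag,
      ((Finset.univ.filter fun f => P p.1 f ∧ P p.2 f).card : ℤ) ≤
        (G.edgeFinset.card : ℤ) ^ 2 * (Fintype.card β : ℤ) ^ n := by
    have hle : ∑ p ∈ G.edgeFinset.offDiag,
        ((Finset.univ.filter fun f => P p.1 f ∧ P p.2 f).card : ℤ) ≤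
          G.edgeFinset.offDiag.card • (Fintype.card β : ℤ) ^ n := by
      refine Finset.sum_le_card_nsmul _ _ _ ?_
      rintro ⟨e, e'⟩ hp
      obtain ⟨he, he', hne⟩ := Finset.mem_offDiag.1 hp
      dsimp only at he he' hne ⊢
      induction e with
      | _ a b =>
      induction e' with
      | _ c d =>
        have hab : G.Adj a b := by simpa using he
        have hcd : G.Adj c d := by simpa using he'
        by_cases ha : a ≠ c ∧ a ≠ d
        · exact_mod_cast (Finset.card_le_card fun f hf => by simpa [hP] using hf).trans
            (card_filter_apply_eq_and_le (β := β) hn hab.ne hcd.ne ha.1 ha.2)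
        · have hb : b ≠ c ∧ b ≠ d := by
            have := hab.ne
            simp only [ne_eq, Sym2.eq_iff] at hne
            grind
          exact_mod_cast (Finset.card_le_card fun f hf => by simpa [hP, eq_comm] using hf).trans
            (card_filter_apply_eq_and_le (β := β) hn hab.ne.symm hcd.ne hb.1 hb.2)
    refine hle.trans ?_
    rw [nsmul_eq_mul, sq]
    refine mul_le_mul_of_nonneg_right ?_ (by positivity)
    rw [Finset.offDiag_card]
    exact_mod_cast Nat.sub_le _ _
  have hbonf := card_filter_forall_not_le G.edgeFinset P
  rw [Fintype.card_fun, hn, Nat.cast_pow] at hbonf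
  rw [hN, hE]
  refine (le_of_eq ?_).trans (hbonf.trans
    (add_le_add (sub_le_sub_left hsingle _) ((le_of_eq ?_).trans hpair))) <;> congr!

/-- A homogeneous form of Bernoulli's inequality. -/
theorem pow_succ_le_sub_two_pow_succ_add {q : ℤ} (hq : 2 ≤ q) (k : ℕ) :
    q ^ (k + 1) ≤ (q - 2) ^ (k + 1) + 2 * (k + 1) * q ^ k := by
  induction k with
  | zero => simp
  | succ k ih =>
    have h := mul_le_mul_of_nonneg_right ih (sub_nonneg.2 hq)
    have hpos : 0 ≤ (k + 1 : ℤ) * q ^ k := by positivity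
    push_cast
    ring_nf at h hpos ⊢
    nlinarith

/-- For a finite simple graph `G` with `g+3` vertices and `3g+3` edges (the dual graph of
a simple cubic planar graph whose Legendrian surface has genus `g`), for all sufficiently
large `x` the number of proper colorings with `x+1` colors satisfies
`N(x+1) < (x-1)^g·(x³-x)`: the moduli space is too small to accommodate the torus chart
`(𝔾ₘ)^g` that a smooth oriented graded exact Lagrangian filling would produce. -/
theorem chromatic_count_lt_torus_chart
    {α : Type*} [Fintype α] (G : SimpleGraph α) (g : ℕ) (hg : 1 ≤ g)
    (hv : Fintype.card α = g + 3)
    (he : Nat.card G.edgeSet = 3 * g + 3) :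
    ∃ x₀ : ℕ, ∀ x : ℕ, x₀ ≤ x →
      (Nat.card {f : α → Fin (x + 1) // ∀ u v : α, G.Adj u v → f u ≠ f v} : ℤ)
        < ((x : ℤ) - 1) ^ g * ((x : ℤ) ^ 3 - (x : ℤ)) := by
  refine ⟨(3 * g + 3) ^ 2 + 1, fun x hx => ?_⟩
  have hN := card_proper_colorings_le (β := Fin (x + 1)) G (n := g + 1) hv
  rw [he, Fintype.card_fin] at hN
  refine hN.trans_lt ?_
  have hx' : (3 * (g : ℤ) + 3) ^ 2 + 1 ≤ x := by exact_mod_cast hx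
  have hg' : (1 : ℤ) ≤ g := by exact_mod_cast hg
  obtain ⟨q, hq⟩ : ∃ q : ℤ, q = x + 1 := ⟨_, rfl⟩
  have hxq : (x : ℤ) = q - 1 := by linarith
  push_cast
  rw [hxq] at hx' ⊢
  have hq2 : 2 ≤ q := by nlinarith [sq_nonneg (3 * (g : ℤ) + 3)]
  have hbern := mul_le_mul_of_nonneg_right (pow_succ_le_sub_two_pow_succ_add hq2 g)
    (show 0 ≤ (q - 1) * q by nlinarith)
  have hlow : (3 * (g : ℤ) + 3) ^ 2 < g * q + (2 * g + 2) := by nlinarith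
  have hmul := mul_lt_mul_of_pos_left hlow (show 0 < q ^ (g + 1) by positivity)
  have hrhs : (q - 1 - 1) ^ g * ((q - 1) ^ 3 - (q - 1)) = (q - 2) ^ (g + 1) * ((q - 1) * q) := by
    ring
  rw [hrhs]
  ring_nf at hbern hmul ⊢
  linarith
end

section
/- Let K be a field and let x, y, z₁, z₂, z₃ ∈ K be pairwise distinct. Define x_a = −((x−z₂)(z₁−z₃))/((z₂−z₁)(z₃−x)), x_b = −((x−z₃)(z₂−z₁))/((z₃−z₂)(z₁−x)), x_c = −((x−z₁)(z₃−z₂))/((z₁−z₃)(z₂−x)), x_d = −((z₂−x)(z₃−y))/((x−z₃)(y−z₂)), x_e = −((z₁−x)(z₂−y))/((x−z₂)(y−z₁)), x_f = −((z₁−y)(z₃−x))/((y−z₃)(x−z₁)), x_g = −((z₁−z₂)(y−z₃))/((z₂−y)(z₃−z₁)), x_h = −((z₃−z₁)(y−z₂))/((z₁−y)(z₂−z₃)), x_i = −((z₂−z₃)(y−z₁))/((z₃−y)(z₁−z₂)). Then: x_a·x_b·x_c = 1; 1 + x_c + x_b·x_c = 0; x_g·x_h·x_i = 1; 1 + x_h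 + x_g·x_h = 0; x_d = −x_a·x_g; x_e = −x_c·x_h; x_f = −x_b·x_i. (These are the defining relations of the chromatic Lagrangian moduli space for the triangular prism graph, exhibiting it as a product of two pairs of pants.) -/
/-- The defining relations of the chromatic Lagrangian for the triangular prism graph:
the nine cross-ratio edge coordinates satisfy the two pair-of-pants relations and the
three relations expressing `x_d, x_e, x_f` in terms of the others. -/
theorem prism_moduli_relations
    {K : Type*} [Field K] (x y z₁ z₂ z₃ : K)
    (hxy : x ≠ y) (hxz₁ : x ≠ z₁) (hxz₂ : x ≠ z₂) (hxz₃ : x ≠ z₃)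
    (hyz₁ : y ≠ z₁) (hyz₂ : y ≠ z₂) (hyz₃ : y ≠ z₃)
    (hz₁z₂ : z₁ ≠ z₂) (hz₁z₃ : z₁ ≠ z₃) (hz₂z₃ : z₂ ≠ z₃) :
    (-((x - z₂) * (z₁ - z₃)) / ((z₂ - z₁) * (z₃ - x)))
        * (-((x - z₃) * (z₂ - z₁)) / ((z₃ - z₂) * (z₁ - x)))
        * (-((x - z₁) * (z₃ - z₂)) / ((z₁ - z₃) * (z₂ - x))) = 1 ∧
    1 + (-((x - z₁) * (z₃ - z₂)) / ((z₁ - z₃) * (z₂ - x)))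
        + (-((x - z₃) * (z₂ - z₁)) / ((z₃ - z₂) * (z₁ - x)))
          * (-((x - z₁) * (z₃ - z₂)) / ((z₁ - z₃) * (z₂ - x))) = 0 ∧
    (-((z₁ - z₂) * (y - z₃)) / ((z₂ - y) * (z₃ - z₁)))
        * (-((z₃ - z₁) * (y - z₂)) / ((z₁ - y) * (z₂ - z₃)))
        * (-((z₂ - z₃) * (y - z₁)) / ((z₃ - y) * (z₁ - z₂))) = 1 ∧
    1 + (-((z₃ - z₁) * (y - z₂)) / ((z₁ - y) * (z₂ - z₃)))
        + (-((z₁ - z₂) * (y - z₃)) / ((z₂ - y) * (z₃ - z₁)))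
          * (-((z₃ - z₁) * (y - z₂)) / ((z₁ - y) * (z₂ - z₃))) = 0 ∧
    (-((z₂ - x) * (z₃ - y)) / ((x - z₃) * (y - z₂)))
      = -((-((x - z₂) * (z₁ - z₃)) / ((z₂ - z₁) * (z₃ - x)))
          * (-((z₁ - z₂) * (y - z₃)) / ((z₂ - y) * (z₃ - z₁)))) ∧
    (-((z₁ - x) * (z₂ - y)) / ((x - z₂) * (y - z₁)))
      = -((-((x - z₁) * (z₃ - z₂)) / ((z₁ - z₃) * (z₂ - x)))
          * (-((z₃ - z₁) * (y - z₂)) / ((z₁ - y) * (z₂ - z₃)))) ∧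
    (-((z₁ - y) * (z₃ - x)) / ((y - z₃) * (x - z₁)))
      = -((-((x - z₃) * (z₂ - z₁)) / ((z₃ - z₂) * (z₁ - x)))
          * (-((z₂ - z₃) * (y - z₁)) / ((z₃ - y) * (z₁ - z₂)))) := by
  have h₁ := sub_ne_zero.2 hxz₁
  have h₂ := sub_ne_zero.2 hxz₂
  have h₃ := sub_ne_zero.2 hxz₃
  have k₁ := sub_ne_zero.2 hyz₁
  have k₂ := sub_ne_zero.2 hyz₂
  have k₃ := sub_ne_zero.2 hyz₃
  have l₁₂ := sub_ne_zero.2 hz₁z₂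
  have l₁₃ := sub_ne_zero.2 hz₁z₃
  have l₂₃ := sub_ne_zero.2 hz₂z₃
  rw [← neg_sub x z₁, ← neg_sub x z₂, ← neg_sub x z₃, ← neg_sub y z₁, ← neg_sub y z₂,
    ← neg_sub y z₃, ← neg_sub z₁ z₂, ← neg_sub z₁ z₃, ← neg_sub z₂ z₃]
  refine ⟨?_, ?_, ?_, ?_, ?_, ?_, ?_⟩ <;> field_simp <;> ring
end

section
/- For every (x₁, x₂, x₃) ∈ ℝ³: (a) the cubic polynomial r³ − (x₁² + x₂² + x₃²)·r + 2·x₁·x₂·x₃ splits over ℝ, i.e. there exist real numbers a, b, c such that r³ − (x₁²+x₂²+x₃²)·r + 2x₁x₂x₃ = (r−a)(r−b)(r−c) for all r ∈ ℝ; and (b) there exists a unique r ∈ ℝ with r ≥ max(|x₁|, |x₂|, |x₃|) satisfying r³ − (x₁²+x₂²+x₃²)·r + 2x₁x₂x₃ = 0 (this r is the largest root). -/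
theorem HarveyLawson.exists_root_ge (x₁ x₂ x₃ : ℝ) :
    ∃ r : ℝ, max (max |x₁| |x₂|) |x₃| ≤ r ∧
      r ^ 3 - (x₁ ^ 2 + x₂ ^ 2 + x₃ ^ 2) * r + 2 * x₁ * x₂ * x₃ = 0 := by
  have h₁ := abs_nonneg x₁
  have h₂ := abs_nonneg x₂
  have h₃ := abs_nonneg x₃
  have hprod : |x₁ * x₂ * x₃| = |x₁| * |x₂| * |x₃| := by rw [abs_mul, abs_mul]
  have hle := le_abs_self (x₁ * x₂ * x₃)
  have hge := neg_abs_le (x₁ * x₂ * x₃)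
  rw [hprod] at hle hge
  set f : ℝ → ℝ := fun r ↦ r ^ 3 - (x₁ ^ 2 + x₂ ^ 2 + x₃ ^ 2) * r + 2 * x₁ * x₂ * x₃ with hf
  have hM : max (max |x₁| |x₂|) |x₃| ≤ |x₁| + |x₂| + |x₃| :=
    max_le (max_le (by linarith) (by linarith)) (by linarith)
  have hfM : f (max (max |x₁| |x₂|) |x₃|) ≤ 0 := by
    simp only [hf]
    rw [← sq_abs x₁, ← sq_abs x₂, ← sq_abs x₃]
    rcases max_choice (max |x₁| |x₂|) |x₃| with h | h
    · rw [h]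
      rcases max_choice |x₁| |x₂| with h' | h'
      · rw [h']; nlinarith [mul_nonneg h₁ (sq_nonneg (|x₂| - |x₃|))]
      · rw [h']; nlinarith [mul_nonneg h₂ (sq_nonneg (|x₁| - |x₃|))]
    · rw [h]; nlinarith [mul_nonneg h₃ (sq_nonneg (|x₁| - |x₂|))]
  have hfR : 0 ≤ f (|x₁| + |x₂| + |x₃|) := by
    simp only [hf]
    rw [← sq_abs x₁, ← sq_abs x₂, ← sq_abs x₃]
    have h₁₂ := mul_nonneg h₁ h₂
    have h₁₃ := mul_nonneg h₁ h₃
    have h₂₃ := mul_nonneg h₂ h₃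
    nlinarith [mul_nonneg h₁₂ h₁, mul_nonneg h₁₂ h₂, mul_nonneg h₁₂ h₃, mul_nonneg h₁₃ h₁,
      mul_nonneg h₁₃ h₃, mul_nonneg h₂₃ h₂, mul_nonneg h₂₃ h₃]
  obtain ⟨r, hr, hr0⟩ := intermediate_value_Icc hM
    (by fun_prop : Continuous f).continuousOn ⟨hfM, hfR⟩
  exact ⟨r, hr.1, hr0⟩

theorem HarveyLawson.root_unique {S P M r s : ℝ} (hM : 0 ≤ M) (hS : S ≤ 3 * M ^ 2)
    (hr : M ≤ r) (hs : M ≤ s) (hr0 : r ^ 3 - S * r + P = 0) (hs0 : s ^ 3 - S * s + P = 0) :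
    r = s := by
  by_contra hne
  have hq : r ^ 2 + r * s + s ^ 2 = S :=
    mul_left_cancel₀ (sub_ne_zero.mpr hne) (by linear_combination hr0 - hs0)
  have hrM : r = M := by nlinarith [mul_nonneg (sub_nonneg.mpr hr) (sub_nonneg.mpr hs)]
  have hsM : s = M := by nlinarith [mul_nonneg (sub_nonneg.mpr hr) (sub_nonneg.mpr hs)]
  exact hne (hrM.trans hsM.symm)

theorem HarveyLawson.sq_prod_le (x₁ x₂ x₃ : ℝ) :
    27 * (x₁ * x₂ * x₃) ^ 2 ≤ (x₁ ^ 2 + x₂ ^ 2 + x₃ ^ 2) ^ 3 := by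
  have h₁ := sq_nonneg x₁
  have h₂ := sq_nonneg x₂
  have h₃ := sq_nonneg x₃
  nlinarith [mul_nonneg h₁ (sq_nonneg (x₂ ^ 2 - x₃ ^ 2)),
    mul_nonneg h₂ (sq_nonneg (x₁ ^ 2 - x₃ ^ 2)), mul_nonneg h₃ (sq_nonneg (x₁ ^ 2 - x₂ ^ 2)),
    mul_nonneg (add_nonneg (add_nonneg h₁ h₂) h₃) (sq_nonneg (x₂ ^ 2 - x₃ ^ 2)),
    mul_nonneg (add_nonneg h₁ h₂) (sq_nonneg (x₁ ^ 2 - x₂ ^ 2)),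
    mul_nonneg (add_nonneg h₁ h₃) (sq_nonneg (x₁ ^ 2 - x₃ ^ 2)),
    mul_nonneg (add_nonneg h₂ h₃) (sq_nonneg (x₂ ^ 2 - x₃ ^ 2))]

/-- A depressed real cubic with a real root and nonnegative discriminant splits over `ℝ`. -/
theorem HarveyLawson.splits_of_root {S P r : ℝ} (hS : 0 ≤ S) (hP : 27 * P ^ 2 ≤ S ^ 3)
    (hr0 : r ^ 3 - S * r + 2 * P = 0) :
    ∃ a b c : ℝ, ∀ t : ℝ, t ^ 3 - S * t + 2 * P = (t - a) * (t - b) * (t - c) := by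
  have hdisc : 0 ≤ 4 * S - 3 * r ^ 2 := by
    by_contra! h
    have hpos : 0 < (3 * r ^ 2 - 4 * S) * (3 * r ^ 2 - S) ^ 2 :=
      mul_pos (by linarith) (pow_pos (by linarith) 2)
    have hsq : r ^ 2 * (r ^ 2 - S) ^ 2 = 4 * P ^ 2 := by
      linear_combination (r ^ 3 - S * r - 2 * P) * hr0
    nlinarith
  have hd := Real.sq_sqrt hdisc
  set d := √(4 * S - 3 * r ^ 2)
  refine ⟨r, (-r + d) / 2, (-r - d) / 2, fun t ↦ ?_⟩
  linear_combination hr0 + (t - r) / 4 * hd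


/-- The Harvey–Lawson cubic `r³ - (x₁²+x₂²+x₃²)r + 2x₁x₂x₃` splits over `ℝ`, and has a
unique root `r` with `r ≥ max(|x₁|,|x₂|,|x₃|)` (the largest root). -/
theorem harveyLawson_cubic_real_roots (x₁ x₂ x₃ : ℝ) :
    (∃ a b c : ℝ, ∀ r : ℝ,
      r ^ 3 - (x₁ ^ 2 + x₂ ^ 2 + x₃ ^ 2) * r + 2 * x₁ * x₂ * x₃
        = (r - a) * (r - b) * (r - c)) ∧
    (∃! r : ℝ, max (max |x₁| |x₂|) |x₃| ≤ r ∧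
      r ^ 3 - (x₁ ^ 2 + x₂ ^ 2 + x₃ ^ 2) * r + 2 * x₁ * x₂ * x₃ = 0) := by
  obtain ⟨r, hr, hr0⟩ := HarveyLawson.exists_root_ge x₁ x₂ x₃
  refine ⟨?_, r, ⟨hr, hr0⟩, ?_⟩
  · obtain ⟨a, b, c, h⟩ := HarveyLawson.splits_of_root (r := r)
      (by positivity : 0 ≤ x₁ ^ 2 + x₂ ^ 2 + x₃ ^ 2) (HarveyLawson.sq_prod_le x₁ x₂ x₃)
      (by linear_combination hr0)
    exact ⟨a, b, c, fun t ↦ by rw [← h t]; ring⟩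
  · rintro s ⟨hs, hs0⟩
    have hM₁ : |x₁| ≤ max (max |x₁| |x₂|) |x₃| := (le_max_left _ _).trans (le_max_left _ _)
    have hM₂ : |x₂| ≤ max (max |x₁| |x₂|) |x₃| := (le_max_right _ _).trans (le_max_left _ _)
    have hM₃ : |x₃| ≤ max (max |x₁| |x₂|) |x₃| := le_max_right _ _
    refine HarveyLawson.root_unique ((abs_nonneg x₁).trans hM₁) ?_ hs hr hs0 hr0
    linarith [sq_le_sq' (abs_le.mp hM₁).1 (abs_le.mp hM₁).2,
      sq_le_sq' (abs_le.mp hM₂).1 (abs_le.mp hM₂).2,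
      sq_le_sq' (abs_le.mp hM₃).1 (abs_le.mp hM₃).2]
end
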